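/- Fix r > 0 and φ ∈ ℝ with Δ(r,φ) > 0. Then the second-order term of the e-expansion of ℬ has, as a function of t, only the Fourier harmonics 0, ±1, ±2: for every integer k with |k| ≥ 3, ∫₀^{2π} (∂²ℬ/∂e²)(0; r, φ, t)·e^{−ikt} dt = 0. -/

import Mathlib

/-- `C(e,ℓ) = (cos(u(e,ℓ)) − e)/(1 − e·cos(u(e,ℓ)))`, the cosine of the true anomaly. -/
noncomputable def Cfun (U : ℝ → ℝ → ℝ) (e ℓ : ℝ) : ℝ :=
  (Real.cos (U e ℓ) - e) / (1 - e * Real.cos (U e ℓ))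

/-- `S(e,ℓ) = √(1−e²)·sin(u(e,ℓ))/(1 − e·cos(u(e,ℓ)))`, the sine of the true anomaly. -/
noncomputable def Sfun (U : ℝ → ℝ → ℝ) (e ℓ : ℝ) : ℝ :=
  Real.sqrt (1 - e ^ 2) * Real.sin (U e ℓ) / (1 - e * Real.cos (U e ℓ))

/-- `ρ(e,t) = 1 − e·cos(u(e,t))`, the radius of the Kepler ellipse. -/
noncomputable def rho (U : ℝ → ℝ → ℝ) (e t : ℝ) : ℝ := 1 - e * Real.cos (U e t)

/-- `Δ(r,φ) = (r² + 1 − 2r·cos φ)^{1/2}`. -/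
noncomputable def Delta (r φ : ℝ) : ℝ := Real.sqrt (r ^ 2 + 1 - 2 * r * Real.cos φ)

/-- `ℬ(e; r, φ, t)`: the reciprocal of the distance between the point with polar
coordinates `(r,φ)` in the rotating frame and the point `q_e(t)` of the Kepler
ellipse of eccentricity `e`. -/
noncomputable def Bfun (U : ℝ → ℝ → ℝ) (r φ e t : ℝ) : ℝ :=
  1 / Real.sqrt (r ^ 2 + rho U e t ^ 2
      - 2 * r * rho U e t
        * (Real.cos (φ + t) * Cfun U e t + Real.sin (φ + t) * Sfun U e t))

open Set Filter Topology

/-- derivative of the eccentric anomaly in the eccentricity -/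
lemma kepler_deriv (u : ℝ → ℝ) (t : ℝ)
    (hu : ∀ e ∈ Set.Ico (0:ℝ) 1, u e - e * Real.sin (u e) = t)
    (a : ℝ) (ha : a ∈ Set.Ico (0:ℝ) 1) :
    HasDerivWithinAt u (Real.sin (u a) / (1 - a * Real.cos (u a))) (Set.Ici 0) a := by
  have hmem : ∀ᶠ e in 𝓝[Set.Ici 0] a, e ∈ Set.Ico (0:ℝ) 1 := by
    filter_upwards [self_mem_nhdsWithin, mem_nhdsWithin_of_mem_nhds (Iio_mem_nhds ha.2)] with e h1 h2
    exact ⟨h1, h2⟩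
  have hkey : ∀ e ∈ Set.Ico (0:ℝ) 1,
      (u e - a * Real.sin (u e)) - (u a - a * Real.sin (u a)) = (e - a) * Real.sin (u e) := by
    intro e he
    have h1 := hu e he
    have h2 := hu a ha
    linear_combination h1 - h2
  have hcont : Tendsto u (𝓝[Set.Ici 0] a) (𝓝 (u a)) := by
    rw [tendsto_iff_norm_sub_tendsto_zero]
    have hb : Tendsto (fun e : ℝ => |e - a| / (1 - a)) (𝓝[Set.Ici 0] a) (𝓝 0) := by
      have : ContinuousWithinAt (fun e : ℝ => |e - a| / (1 - a)) (Set.Ici 0) a := by fun_prop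
      simpa [ContinuousWithinAt] using this
    refine squeeze_zero' (Eventually.of_forall fun e => norm_nonneg _) ?_ hb
    filter_upwards [hmem] with e he
    have h1a : 0 < 1 - a := by linarith [ha.2]
    rw [le_div_iff₀ h1a, Real.norm_eq_abs]
    have h3 : u e - u a = a * (Real.sin (u e) - Real.sin (u a)) + (e - a) * Real.sin (u e) := by
      linear_combination hkey e he
    have h4 : |Real.sin (u e) - Real.sin (u a)| ≤ |u e - u a| := by
      have := Real.lipschitzWith_sin.dist_le_mul (u e) (u a)
      simpa [Real.dist_eq] using this
    have h5 : |u e - u a| ≤ a * |u e - u a| + |e - a| := by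
      calc |u e - u a| = |a * (Real.sin (u e) - Real.sin (u a)) + (e - a) * Real.sin (u e)| := by
            rw [← h3]
        _ ≤ |a * (Real.sin (u e) - Real.sin (u a))| + |(e - a) * Real.sin (u e)| := abs_add_le _ _
        _ ≤ a * |u e - u a| + |e - a| := by
            rw [abs_mul, abs_mul, abs_of_nonneg ha.1]
            have h6 := mul_le_mul_of_nonneg_left h4 ha.1
            have h7 := mul_le_of_le_one_right (abs_nonneg (e - a)) (Real.abs_sin_le_one (u e))
            linarith
    linarith
  have hg : HasDerivAt (fun x => x - a * Real.sin x) (1 - a * Real.cos (u a)) (u a) :=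
    (hasDerivAt_id _).sub ((Real.hasDerivAt_sin _).const_mul a)
  have hne : 1 - a * Real.cos (u a) ≠ 0 := by
    have := mul_le_mul_of_nonneg_left (Real.cos_le_one (u a)) ha.1
    have := ha.2
    apply ne_of_gt; linarith
  set g : ℝ → ℝ := fun x => x - a * Real.sin x with hgdef
  have hd : ContinuousAt (dslope g (u a)) (u a) := continuousAt_dslope_same.2 hg.differentiableAt
  have hd0 : dslope g (u a) (u a) = 1 - a * Real.cos (u a) := by
    rw [dslope_same, hg.deriv]
  have hdt : Tendsto (fun e => dslope g (u a) (u e)) (𝓝[Set.Ici 0] a)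
      (𝓝 (1 - a * Real.cos (u a))) := by
    have := hd.tendsto.comp hcont
    rwa [hd0] at this
  have hst : Tendsto (fun e => Real.sin (u e)) (𝓝[Set.Ici 0] a) (𝓝 (Real.sin (u a))) :=
    (Real.continuous_sin.tendsto _).comp hcont
  rw [hasDerivWithinAt_iff_tendsto_slope]
  have hlim := (hst.div hdt hne).mono_left (nhdsWithin_mono a (sdiff_subset (t := {a})))
  refine hlim.congr' ?_
  have hle : 𝓝[Set.Ici 0 \ {a}] a ≤ 𝓝[Set.Ici 0] a := nhdsWithin_mono a sdiff_subset
  filter_upwards [hle hmem, hle (hdt.eventually_ne hne), self_mem_nhdsWithin] with e he h1 h2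
  have h3 : e - a ≠ 0 := sub_ne_zero.2 h2.2
  have h4 : (u e - u a) * dslope g (u a) (u e) = g (u e) - g (u a) := by
    simpa using sub_smul_dslope g (u a) (u e)
  have h5 := hkey e he
  rw [slope_def_field, Pi.div_apply, div_eq_div_iff h1 h3]
  simp only [hgdef] at h4
  simp only [hgdef]
  linear_combination (-1 : ℝ) * h5 - h4

lemma second_deriv (U : ℝ → ℝ → ℝ)
    (hU : ∀ e ∈ Set.Ico (0:ℝ) 1, ∀ ℓ : ℝ, U e ℓ - e * Real.sin (U e ℓ) = ℓ)
    (r φ : ℝ) (hΔ : 0 < Delta r φ) (t : ℝ) :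
    iteratedDerivWithin 2 (fun e : ℝ => Bfun U r φ e t) (Set.Ici 0) 0 =
      3 / (4 * Delta r φ ^ 5) *
        ((-2 + 2 * r * Real.cos φ) * Real.cos t - 4 * r * Real.sin φ * Real.sin t) ^ 2
      - 1 / (2 * Delta r φ ^ 3) *
        (2 * Real.cos t ^ 2 + 4 * Real.sin t ^ 2
          - 2 * r * (-2 * Real.cos φ * Real.sin t ^ 2 + Real.sin φ * Real.sin t * Real.cos t)) := by
  set u : ℝ → ℝ := fun e => U e t with hudef
  have hu : ∀ e ∈ Set.Ico (0:ℝ) 1, u e - e * Real.sin (u e) = t := fun e he => hU e he t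
  have hu0 : u 0 = t := by simpa using hu 0 (by simp)
  have hrho : ∀ e ∈ Set.Ico (0:ℝ) 1, 0 < 1 - e * Real.cos (u e) := by
    intro e he
    have := mul_le_mul_of_nonneg_left (Real.cos_le_one (u e)) he.1
    have := he.2
    linarith
  set α := φ + t with hα
  let u1 : ℝ → ℝ := fun e => Real.sin (u e) / (1 - e * Real.cos (u e))
  let w : ℝ → ℝ := fun e => Real.sqrt (1 - e ^ 2)
  let F : ℝ → ℝ := fun e => r ^ 2 + (1 - e * Real.cos (u e)) ^ 2
    - 2 * r * (Real.cos α * (Real.cos (u e) - e) + Real.sin α * (w e * Real.sin (u e)))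
  let P : ℝ → ℝ := fun e => 2 * (1 - e * Real.cos (u e)) *
      (-(Real.cos (u e)) + e * (Real.sin (u e) * u1 e))
    - 2 * r * (Real.cos α * (-(Real.sin (u e) * u1 e) - 1)
      + Real.sin α * (-e / w e * Real.sin (u e) + w e * (Real.cos (u e) * u1 e)))
  let s : ℝ → ℝ := fun e => Real.sqrt (F e)
  have hw : ∀ e ∈ Set.Ico (0:ℝ) 1, HasDerivWithinAt w (-e / w e) (Set.Ici 0) e := by
    intro e he
    have hpos : 0 < 1 - e ^ 2 := by nlinarith [he.1, he.2]
    have h := (((hasDerivAt_id e).pow 2).const_sub 1).sqrt (by simpa using hpos.ne')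
    refine (h.congr_deriv ?_).hasDerivWithinAt
    simp [w]
    field_simp
  have hud : ∀ e ∈ Set.Ico (0:ℝ) 1, HasDerivWithinAt u (u1 e) (Set.Ici 0) e :=
    fun e he => kepler_deriv u t hu e he
  have hF : ∀ e ∈ Set.Ico (0:ℝ) 1, HasDerivWithinAt F (P e) (Set.Ici 0) e := by
    intro e he
    have hc := (hud e he).cos
    have hs := (hud e he).sin
    have hi := hasDerivWithinAt_id e (Set.Ici (0:ℝ))
    have h := ((((hi.mul hc).const_sub 1).pow 2).const_add (r ^ 2)).sub
      ((((hc.sub hi).const_mul (Real.cos α)).add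
        (((hw e he).mul hs).const_mul (Real.sin α))).const_mul (2 * r))
    refine h.congr_deriv ?_
    simp only [P, id, Pi.mul_apply]
    push_cast
    ring
  have hF0 : F 0 = r ^ 2 + 1 - 2 * r * Real.cos φ := by
    have : Real.cos φ = Real.cos α * Real.cos t + Real.sin α * Real.sin t := by
      rw [← Real.cos_sub]; congr 1; simp [hα]
    simp [F, hu0, w, this]
  have hs0 : s 0 = Delta r φ := by simp only [s, Delta, hF0]
  have hF0pos : 0 < F 0 := by
    rw [hF0]; exact Real.sqrt_pos.1 hΔ
  have hsd : ∀ e ∈ Set.Ico (0:ℝ) 1, 0 < F e →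
      HasDerivWithinAt s (P e / (2 * s e)) (Set.Ici 0) e := by
    intro e he hFe
    exact (hF e he).sqrt hFe.ne'
  have hBs : ∀ e ∈ Set.Ico (0:ℝ) 1, Bfun U r φ e t = (s e)⁻¹ := by
    intro e he
    have h1 : 1 - e * Real.cos (U e t) ≠ 0 := (hrho e he).ne'
    simp only [Bfun, rho, Cfun, Sfun, s, F, w, one_div, hudef]
    congr 2
    field_simp
    rw [hα]
    ring
  have hmem : ∀ᶠ e in 𝓝[Set.Ici 0] (0:ℝ), e ∈ Set.Ico (0:ℝ) 1 := by
    filter_upwards [self_mem_nhdsWithin,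
      mem_nhdsWithin_of_mem_nhds (Iio_mem_nhds (zero_lt_one (α := ℝ)))] with e h1 h2
    exact ⟨h1, h2⟩
  have h00 : (0:ℝ) ∈ Set.Ico (0:ℝ) 1 := by simp
  have hFpos : ∀ᶠ e in 𝓝[Set.Ici 0] (0:ℝ), 0 < F e :=
    (hF 0 h00).continuousWithinAt.eventually (lt_mem_nhds hF0pos)
  have hD1 : ∀ᶠ e in 𝓝[Set.Ici 0] (0:ℝ),
      iteratedDerivWithin 1 (fun e : ℝ => Bfun U r φ e t) (Set.Ici 0) e
        = -(P e / (2 * s e)) / s e ^ 2 := by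
    filter_upwards [hmem, hFpos] with e he hFe
    have hspos : 0 < s e := Real.sqrt_pos.2 hFe
    rw [iteratedDerivWithin_one]
    have h1 := (hsd e he hFe).fun_inv hspos.ne'
    refine HasDerivWithinAt.derivWithin (h1.congr_of_eventuallyEq ?_ (hBs e he))
      (uniqueDiffOn_Ici 0 e he.1)
    filter_upwards [self_mem_nhdsWithin, mem_nhdsWithin_of_mem_nhds (Iio_mem_nhds he.2)]
      with x h1 h2
    exact hBs x ⟨h1, h2⟩
  have hu1 : HasDerivWithinAt u1 (2 * Real.sin t * Real.cos t) (Set.Ici 0) 0 := by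
    have hc := (hud 0 h00).cos
    have hs := (hud 0 h00).sin
    have hi := hasDerivWithinAt_id 0 (Set.Ici (0:ℝ))
    have h := hs.div ((hi.mul hc).const_sub 1) (by simp)
    refine h.congr_deriv ?_
    simp [u1, hu0]
    ring
  have hu10 : u1 0 = Real.sin t := by simp [u1, hu0]
  have hw0 : w 0 = 1 := by simp [w]
  have hP : HasDerivWithinAt P (2 * Real.cos t ^ 2 + 4 * Real.sin t ^ 2
      - 2 * r * (-2 * Real.cos φ * Real.sin t ^ 2 + Real.sin φ * Real.sin t * Real.cos t))
      (Set.Ici 0) 0 := by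
    have hc := (hud 0 h00).cos
    have hs := (hud 0 h00).sin
    have hi := hasDerivWithinAt_id 0 (Set.Ici (0:ℝ))
    have hww := hw 0 h00
    have h := ((((hi.mul hc).const_sub 1).const_mul 2).mul
        (hc.neg.add (hi.mul (hs.mul hu1)))).sub
      (((((hs.mul hu1).neg.sub_const 1).const_mul (Real.cos α)).add
        ((((hi.neg.div hww (by simp [hw0])).mul hs).add
          (hww.mul (hc.mul hu1))).const_mul (Real.sin α))).const_mul (2 * r))
    refine h.congr_deriv ?_
    simp [hu0, hu10, hw0, hα, Real.cos_add, Real.sin_add]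
    have := Real.sin_sq_add_cos_sq t
    have h3 : Real.sin t ^ 2 = 1 - Real.cos t ^ 2 := by linarith
    have h4 : Real.sin t ^ 3 = Real.sin t * (1 - Real.cos t ^ 2) := by rw [← h3]; ring
    have h5 : Real.sin t ^ 4 = (1 - Real.cos t ^ 2) ^ 2 := by rw [← h3]; ring
    ring_nf
    simp only [h3, h4, h5]
    ring
  have hP0 : P 0 = (-2 + 2 * r * Real.cos φ) * Real.cos t - 4 * r * Real.sin φ * Real.sin t := by
    simp [P, hu0, hu10, hw0, hα, Real.cos_add, Real.sin_add]
    have := Real.sin_sq_add_cos_sq t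
    have h3 : Real.sin t ^ 2 = 1 - Real.cos t ^ 2 := by linarith
    have h4 : Real.sin t ^ 3 = Real.sin t * (1 - Real.cos t ^ 2) := by rw [← h3]; ring
    ring_nf
    simp only [h3, h4]
    ring
  rw [iteratedDerivWithin_succ (n := 1)]
  have hspos : 0 < s 0 := by rw [hs0]; exact hΔ
  have hss := hsd 0 h00 hF0pos
  have h := ((hP.div (hss.const_mul 2) (by positivity)).neg.div (hss.pow 2)
    (by simpa using hspos.ne')).congr_of_eventuallyEq
      (f₁ := iteratedDerivWithin 1 (fun e : ℝ => Bfun U r φ e t) (Set.Ici 0)) hD1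
      (hD1.self_of_nhdsWithin (by simp))
  rw [h.derivWithin (uniqueDiffOn_Ici 0 0 (by simp))]
  simp only [Pi.neg_apply, Pi.div_apply, Pi.pow_apply, hP0, hs0]
  field_simp
  ring

lemma exp_int (m : ℤ) (hm : m ≠ 0) :
    (∫ t in (0:ℝ)..(2 * Real.pi), Complex.exp ((m * Complex.I) * (t : ℂ))) = 0 := by
  rw [integral_exp_mul_complex (by simp [hm])]
  have : Complex.exp (m * Complex.I * ((2 * Real.pi : ℝ) : ℂ)) = 1 := by
    rw [Complex.exp_eq_one_iff]
    exact ⟨m, by push_cast; ring⟩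
  rw [this]; simp

/-- Fix `r > 0` and `φ` with `Δ(r,φ) > 0`. The second-order
term `(∂²ℬ/∂e²)(0; r, φ, t)` of the `e`-expansion of `ℬ` has, as a function of
`t`, only the Fourier harmonics `0, ±1, ±2`: for every integer `k` with
`|k| ≥ 3`, `∫₀^{2π} (∂²ℬ/∂e²)(0; r, φ, t)·e^{−ikt} dt = 0`. -/
theorem stmt_12 (U : ℝ → ℝ → ℝ)
    (hU : ∀ e ∈ Set.Ico (0:ℝ) 1, ∀ ℓ : ℝ, U e ℓ - e * Real.sin (U e ℓ) = ℓ)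
    (r φ : ℝ) (hr : 0 < r) (hΔ : 0 < Delta r φ) :
    ∀ k : ℤ, 3 ≤ |k| →
      (∫ t in (0:ℝ)..(2 * Real.pi),
        ((iteratedDerivWithin 2 (fun e : ℝ => Bfun U r φ e t) (Set.Ici 0) 0 : ℝ) : ℂ)
          * Complex.exp (-((k : ℂ) * Complex.I * (t : ℂ)))) = 0 := by
  intro k hk
  have hk2 : -k ≠ 0 ∧ 2 - k ≠ 0 ∧ -2 - k ≠ 0 := by
    rcases abs_cases k with h | h <;> omega
  obtain ⟨X, Y, Z, hXYZ⟩ : ∃ X Y Z : ℝ, ∀ t : ℝ,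
      iteratedDerivWithin 2 (fun e : ℝ => Bfun U r φ e t) (Set.Ici 0) 0
        = X * Real.cos t ^ 2 + Y * (Real.cos t * Real.sin t) + Z * Real.sin t ^ 2 := by
    refine ⟨3 / (4 * Delta r φ ^ 5) * (-2 + 2 * r * Real.cos φ) ^ 2 - 1 / (2 * Delta r φ ^ 3) * 2,
      3 / (4 * Delta r φ ^ 5) * (-8 * r * Real.sin φ * (-2 + 2 * r * Real.cos φ))
        + 1 / (2 * Delta r φ ^ 3) * (2 * r * Real.sin φ),
      3 / (4 * Delta r φ ^ 5) * (4 * r * Real.sin φ) ^ 2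
        - 1 / (2 * Delta r φ ^ 3) * (4 + 4 * r * Real.cos φ), fun t => ?_⟩
    rw [second_deriv U hU r φ hΔ t]
    ring
  obtain ⟨h0, h2, hm2⟩ := hk2
  have hI : ∀ t : ℝ,
      ((iteratedDerivWithin 2 (fun e : ℝ => Bfun U r φ e t) (Set.Ici 0) 0 : ℝ) : ℂ)
          * Complex.exp (-((k : ℂ) * Complex.I * (t : ℂ)))
      = ((X + Z) / 2 : ℂ) * Complex.exp ((((-k : ℤ) : ℂ) * Complex.I) * (t : ℂ))
        + ((X - Z) / 4 - Y * Complex.I / 4 : ℂ)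
          * Complex.exp ((((2 - k : ℤ) : ℂ) * Complex.I) * (t : ℂ))
        + ((X - Z) / 4 + Y * Complex.I / 4 : ℂ)
          * Complex.exp ((((-2 - k : ℤ) : ℂ) * Complex.I) * (t : ℂ)) := by
    intro t
    rw [hXYZ t]
    have e1 : Complex.exp ((((-k : ℤ) : ℂ) * Complex.I) * (t : ℂ))
        = Complex.exp (-((k : ℂ) * Complex.I * (t : ℂ))) := by
      congr 1; push_cast; ring
    have e2 : Complex.exp ((((2 - k : ℤ) : ℂ) * Complex.I) * (t : ℂ))
        = Complex.exp (t * Complex.I) ^ 2 * Complex.exp (-((k : ℂ) * Complex.I * (t : ℂ))) := by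
      rw [← Complex.exp_nat_mul, ← Complex.exp_add]
      congr 1; push_cast; ring
    have e3 : Complex.exp ((((-2 - k : ℤ) : ℂ) * Complex.I) * (t : ℂ))
        = Complex.exp (-t * Complex.I) ^ 2 * Complex.exp (-((k : ℂ) * Complex.I * (t : ℂ))) := by
      rw [← Complex.exp_nat_mul, ← Complex.exp_add]
      congr 1; push_cast; ring
    rw [e1, e2, e3]
    have hsc := Complex.sin_sq_add_cos_sq (t : ℂ)
    have hx : Complex.exp (t * Complex.I) = Complex.cos t + Complex.sin t * Complex.I :=
      Complex.exp_mul_I _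
    have hy : Complex.exp (-t * Complex.I) = Complex.cos t - Complex.sin t * Complex.I := by
      rw [Complex.exp_mul_I, Complex.cos_neg, Complex.sin_neg]; ring
    rw [hx, hy]
    push_cast
    generalize Complex.exp (-((k : ℂ) * Complex.I * (t : ℂ))) = E
    generalize Complex.cos (t : ℂ) = c at *
    generalize Complex.sin (t : ℂ) = s at *
    have hII := Complex.I_sq
    linear_combination ((X + Z) / 2 * E) * hsc
      - ((X - Z) / 2 * s ^ 2 * E - Y * c * s * E) * hII
  simp_rw [hI]
  have hint : ∀ (A : ℂ) (m : ℤ), IntervalIntegrable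
      (fun t : ℝ => A * Complex.exp (((m : ℂ) * Complex.I) * (t : ℂ)))
      MeasureTheory.volume 0 (2 * Real.pi) := by
    intro A m
    apply Continuous.intervalIntegrable
    fun_prop
  rw [intervalIntegral.integral_add ((hint _ _).add (hint _ _)) (hint _ _),
    intervalIntegral.integral_add (hint _ _) (hint _ _)]
  simp only [intervalIntegral.integral_const_mul]
  rw [exp_int _ h0, exp_int _ h2, exp_int _ hm2]
  simp
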